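/- Let I be a countable index set and, for each k ≥ 1, let X^k = (X^k_i)_{i∈I} be a family of random elements of a partially ordered Polish space X with closed partial order. Suppose each X^k is negatively associated and X^k converges in distribution to X = (X_i)_{i∈I} (as random elements of the product space X^I) as k → ∞. Then X is negatively associated. -/

import Mathlib

open MeasureTheory Filter

/-- A family `(Xs i)_{i ∈ ι}` of random elements of a partially ordered measurable space `X`
is *negatively associated* if for every index set `J ⊆ ι` and all bounded measurable
coordinatewise nondecreasing `f : X^J → ℝ`, `g : X^{Jᶜ} → ℝ`, one has
`E[f(X_J) g(X_{Jᶜ})] ≤ E[f(X_J)] E[g(X_{Jᶜ})]`. -/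
def NegAssoc {Ω ι X : Type*} [MeasurableSpace Ω] [MeasurableSpace X] [Preorder X]
    (P : Measure Ω) (Xs : ι → Ω → X) : Prop :=
  ∀ (J : Set ι) (f : (J → X) → ℝ) (g : ((Jᶜ : Set ι) → X) → ℝ),
    Measurable f → Monotone f → (∃ C, ∀ x, |f x| ≤ C) →
    Measurable g → Monotone g → (∃ C, ∀ x, |g x| ≤ C) →
    ∫ ω, f (fun j => Xs j.1 ω) * g (fun j => Xs j.1 ω) ∂P ≤
      (∫ ω, f (fun j => Xs j.1 ω) ∂P) * ∫ ω, g (fun j => Xs j.1 ω) ∂P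

open Set Topology
open scoped ENNReal NNReal

/-- The upper closure of a compact set is closed when the order is closed. -/
theorem IsCompact.isClosed_upperClosure {Y : Type*} [TopologicalSpace Y] [Preorder Y]
    [OrderClosedTopology Y] {K : Set Y} (hK : IsCompact K) :
    IsClosed (upperClosure K : Set Y) := by
  rw [← isOpen_compl_iff, isOpen_iff_mem_nhds]
  intro y hy
  have hev : ∀ᶠ z in 𝓝 y, ∀ x ∈ K, ¬ x ≤ z :=
    hK.eventually_forall_of_forall_eventually fun x hx =>
      (isClosed_le continuous_snd continuous_fst).isOpen_compl.mem_nhds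
        fun hxy => hy (mem_upperClosure.2 ⟨x, hx, hxy⟩)
  filter_upwards [hev] with z hz hzK
  obtain ⟨x, hx, hxz⟩ := mem_upperClosure.1 hzK
  exact hz x hx hxz

/-- Inside a compact set `T`, the upper closures of the closed thickenings of a compact set `K`
shrink to a subset of the upper closure of `K`. -/
theorem iInter_upperClosure_inter_cthickening_subset {Y : Type*} [MetricSpace Y] [Preorder Y]
    [OrderClosedTopology Y] {T K : Set Y} (hT : IsCompact T) (hK : IsCompact K)
    {δ : ℕ → ℝ} (hδ : Antitone δ) (hδ0 : Tendsto δ atTop (𝓝 0)) :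
    ⋂ n, (upperClosure (T ∩ Metric.cthickening (δ n) K) : Set Y) ⊆ upperClosure K := by
  intro y hy
  have hclosed : ∀ n, IsClosed ((T ∩ Metric.cthickening (δ n) K) ∩ Iic y) := fun n =>
    (hT.isClosed.inter Metric.isClosed_cthickening).inter isClosed_Iic
  obtain ⟨x, hx⟩ := IsCompact.nonempty_iInter_of_sequence_nonempty_isCompact_isClosed
    (fun n => (T ∩ Metric.cthickening (δ n) K) ∩ Iic y)
    (fun n => inter_subset_inter_left _
      (inter_subset_inter_right _ (Metric.cthickening_mono (hδ n.le_succ) K)))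
    (fun n => by
      obtain ⟨x, hx, hxy⟩ := mem_upperClosure.1 (mem_iInter.1 hy n)
      exact ⟨x, hx, hxy⟩)
    (hT.of_isClosed_subset (hclosed 0) (fun x hx => hx.1.1)) hclosed
  rw [mem_iInter] at hx
  refine mem_upperClosure.2 ⟨x, ?_, (hx 0).2⟩
  rw [← hK.isClosed.closure_eq, ← Metric.cthickening_zero,
    Metric.cthickening_eq_iInter_cthickening]
  refine mem_iInter₂.2 fun η hη => ?_
  obtain ⟨n, hn⟩ := (hδ0.eventually (gt_mem_nhds hη)).exists
  exact Metric.cthickening_mono hn.le K (hx n).1.2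

/-- A measurable upper set is approximated in measure by an open set that is, within a given
compact set, contained in a closed upper set of almost the same measure. -/
theorem IsUpperSet.exists_isOpen_isClosed_measure_le {Y : Type*} [TopologicalSpace Y]
    [PolishSpace Y] [MeasurableSpace Y] [BorelSpace Y] [Preorder Y] [OrderClosedTopology Y]
    (Q : Measure Y) [IsFiniteMeasure Q] {A T : Set Y} (hA : IsUpperSet A)
    (hAm : MeasurableSet A) (hT : IsCompact T) {ε : ℝ≥0∞} (hε : ε ≠ 0) :
    ∃ U F : Set Y, IsOpen U ∧ IsClosed F ∧ IsUpperSet F ∧ U ∩ T ⊆ F ∧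
      Q F ≤ Q A + ε ∧ Q (A \ U) ≤ ε := by
  let := TopologicalSpace.upgradeIsCompletelyMetrizable Y
  obtain ⟨K, hKA, hK, hQK⟩ := hAm.exists_isCompact_sdiff_lt (measure_ne_top Q A) hε
  obtain ⟨δ, hδ, hδpos, hδ0⟩ := exists_seq_strictAnti_tendsto (0 : ℝ)
  set S : ℕ → Set Y := fun n => upperClosure (T ∩ Metric.cthickening (δ n) K)
  have hSc : ∀ n, IsClosed (S n) := fun n =>
    (hT.inter_right Metric.isClosed_cthickening).isClosed_upperClosure
  have hanti : Antitone S := fun m n hmn => upperClosure_anti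
    (inter_subset_inter_right _ (Metric.cthickening_mono (hδ.antitone hmn) K))
  have hlim := tendsto_measure_iInter_atTop (μ := Q)
    (fun n => (hSc n).measurableSet.nullMeasurableSet) hanti ⟨0, measure_ne_top Q _⟩
  have hlt : Q (⋂ n, S n) < Q A + ε :=
    (measure_mono ((iInter_upperClosure_inter_cthickening_subset hT hK hδ.antitone hδ0).trans
      (upperClosure_min hKA hA))).trans_lt
      (ENNReal.lt_add_right (measure_ne_top Q A) hε)
  obtain ⟨n, hn⟩ := (hlim.eventually (gt_mem_nhds hlt)).exists
  refine ⟨Metric.thickening (δ n) K, S n, Metric.isOpen_thickening, hSc n, UpperSet.upper _,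
    ?_, hn.le, ?_⟩
  · rintro x ⟨hx, hxT⟩
    exact subset_upperClosure ⟨hxT, Metric.thickening_subset_cthickening _ _ hx⟩
  · exact (measure_mono (sdiff_subset_sdiff_right
      (Metric.self_subset_thickening (hδpos n) K))).trans hQK.le

/-- A weakly convergent sequence of probability measures on a Polish space is tight. -/
theorem exists_isCompact_measure_compl_le_of_tendsto {Ω : Type*} [TopologicalSpace Ω]
    [PolishSpace Ω] [MeasurableSpace Ω] [BorelSpace Ω] {μs : ℕ → ProbabilityMeasure Ω}
    {μ : ProbabilityMeasure Ω} (h : Tendsto μs atTop (𝓝 μ)) {ε : ℝ≥0∞} (hε : 0 < ε) :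
    ∃ T : Set Ω, IsCompact T ∧ ∀ k, (μs k : Measure Ω) Tᶜ ≤ ε := by
  let := TopologicalSpace.upgradeIsCompletelyMetrizable Ω
  have hcomp : IsCompact (closure (range μs)) :=
    h.isCompact_insert_range.closure_of_subset (subset_insert _ _)
  obtain ⟨T, hT, hle⟩ := isTightMeasureSet_iff_exists_isCompact_measure_compl_le.1
    (isTightMeasureSet_of_isCompact_closure hcomp) ε hε
  exact ⟨T, hT, fun k => hle _ ⟨μs k, mem_range_self k, rfl⟩⟩

/-- Negative dependence of upper sets passes to weak limits. -/
theorem measure_inter_le_mul_of_tendsto {Ω Y Z : Type*} [TopologicalSpace Ω]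
    [PolishSpace Ω] [MeasurableSpace Ω] [BorelSpace Ω]
    [TopologicalSpace Y] [PolishSpace Y] [MeasurableSpace Y] [BorelSpace Y] [Preorder Y]
    [OrderClosedTopology Y]
    [TopologicalSpace Z] [PolishSpace Z] [MeasurableSpace Z] [BorelSpace Z] [Preorder Z]
    [OrderClosedTopology Z]
    {μs : ℕ → ProbabilityMeasure Ω} {μ : ProbabilityMeasure Ω} (h : Tendsto μs atTop (𝓝 μ))
    {p : Ω → Y} {q : Ω → Z} (hp : Continuous p) (hq : Continuous q)
    (hneg : ∀ k (A : Set Y) (B : Set Z), MeasurableSet A → IsUpperSet A → MeasurableSet B →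
      IsUpperSet B → (μs k : Measure Ω) (p ⁻¹' A ∩ q ⁻¹' B) ≤
        (μs k : Measure Ω) (p ⁻¹' A) * (μs k : Measure Ω) (q ⁻¹' B))
    {A : Set Y} {B : Set Z} (hAm : MeasurableSet A) (hA : IsUpperSet A) (hBm : MeasurableSet B)
    (hB : IsUpperSet B) :
    (μ : Measure Ω) (p ⁻¹' A ∩ q ⁻¹' B) ≤
      (μ : Measure Ω) (p ⁻¹' A) * (μ : Measure Ω) (q ⁻¹' B) := by
  set P : Measure Ω := (μ : Measure Ω)
  have key : ∀ ε : ℝ≥0∞, 0 < ε → P (p ⁻¹' A ∩ q ⁻¹' B) ≤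
      (P (p ⁻¹' A) + ε + ε) * (P (q ⁻¹' B) + ε + ε) + ε + (ε + ε) := by
    intro ε hε
    rcases eq_or_ne ε ∞ with rfl | hεtop
    · simp
    obtain ⟨T, hT, hTle⟩ := exists_isCompact_measure_compl_le_of_tendsto h hε
    obtain ⟨U, F, hU, hFc, hFu, hUF, hF, hAU⟩ := hA.exists_isOpen_isClosed_measure_le
      (P.map p) hAm (hT.image hp) hε.ne'
    obtain ⟨V, G, hV, hGc, hGu, hVG, hG, hBV⟩ := hB.exists_isOpen_isClosed_measure_le
      (P.map q) hBm (hT.image hq) hε.ne'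
    rw [Measure.map_apply hp.measurable hFc.measurableSet,
      Measure.map_apply hp.measurable hAm] at hF
    rw [Measure.map_apply hp.measurable (hAm.diff hU.measurableSet)] at hAU
    rw [Measure.map_apply hq.measurable hGc.measurableSet,
      Measure.map_apply hq.measurable hBm] at hG
    rw [Measure.map_apply hq.measurable (hBm.diff hV.measurableSet)] at hBV
    have hopen : P (p ⁻¹' U ∩ q ⁻¹' V) ≤
        (P (p ⁻¹' A) + ε + ε) * (P (q ⁻¹' B) + ε + ε) + ε := by
      refine (ProbabilityMeasure.le_liminf_measure_open_of_tendsto h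
        ((hU.preimage hp).inter (hV.preimage hq))).trans ?_
      have hFlt : ∀ᶠ k in atTop, (μs k : Measure Ω) (p ⁻¹' F) < P (p ⁻¹' A) + ε + ε :=
        eventually_lt_of_limsup_lt
          ((ProbabilityMeasure.limsup_measure_closed_le_of_tendsto h
            (hFc.preimage hp)).trans_lt (hF.trans_lt (ENNReal.lt_add_right (by finiteness) hε.ne')))
      have hGlt : ∀ᶠ k in atTop, (μs k : Measure Ω) (q ⁻¹' G) < P (q ⁻¹' B) + ε + ε :=
        eventually_lt_of_limsup_lt
          ((ProbabilityMeasure.limsup_measure_closed_le_of_tendsto h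
            (hGc.preimage hq)).trans_lt (hG.trans_lt (ENNReal.lt_add_right (by finiteness) hε.ne')))
      refine liminf_le_of_frequently_le' (Eventually.frequently ?_)
      filter_upwards [hFlt, hGlt] with k hkF hkG
      have hsub : p ⁻¹' U ∩ q ⁻¹' V ⊆ (p ⁻¹' F ∩ q ⁻¹' G) ∪ Tᶜ := by
        rintro x ⟨hxU, hxV⟩
        by_cases hx : x ∈ T
        · exact Or.inl ⟨hUF ⟨hxU, mem_image_of_mem p hx⟩, hVG ⟨hxV, mem_image_of_mem q hx⟩⟩
        · exact Or.inr hx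
      calc (μs k : Measure Ω) (p ⁻¹' U ∩ q ⁻¹' V)
          ≤ (μs k : Measure Ω) (p ⁻¹' F ∩ q ⁻¹' G) + (μs k : Measure Ω) Tᶜ :=
            (measure_mono hsub).trans (measure_union_le _ _)
        _ ≤ _ := add_le_add ((hneg k F G hFc.measurableSet hFu hGc.measurableSet hGu).trans
            (mul_le_mul' hkF.le hkG.le)) (hTle k)
    have hsub : p ⁻¹' A ∩ q ⁻¹' B ⊆
        (p ⁻¹' U ∩ q ⁻¹' V) ∪ (p ⁻¹' (A \ U) ∪ q ⁻¹' (B \ V)) := by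
      rintro x ⟨hxA, hxB⟩
      by_cases hxU : p x ∈ U
      · by_cases hxV : q x ∈ V
        · exact Or.inl ⟨hxU, hxV⟩
        · exact Or.inr (Or.inr ⟨hxB, hxV⟩)
      · exact Or.inr (Or.inl ⟨hxA, hxU⟩)
    calc P (p ⁻¹' A ∩ q ⁻¹' B)
        ≤ P (p ⁻¹' U ∩ q ⁻¹' V) + (P (p ⁻¹' (A \ U)) + P (q ⁻¹' (B \ V))) :=
          (measure_mono hsub).trans ((measure_union_le _ _).trans
            (add_le_add le_rfl (measure_union_le _ _)))
      _ ≤ _ := add_le_add hopen (add_le_add hAU hBV)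
  have hid : Tendsto (fun ε : ℝ≥0∞ => ε) (𝓝[>] 0) (𝓝 0) :=
    tendsto_nhdsWithin_of_tendsto_nhds tendsto_id
  have hlim : Tendsto (fun ε : ℝ≥0∞ =>
      (P (p ⁻¹' A) + ε + ε) * (P (q ⁻¹' B) + ε + ε) + ε + (ε + ε)) (𝓝[>] 0)
      (𝓝 ((P (p ⁻¹' A) + 0 + 0) * (P (q ⁻¹' B) + 0 + 0) + 0 + (0 + 0))) := by
    refine ((ENNReal.Tendsto.mul ((hid.const_add _).add hid) (Or.inr (by finiteness))
      ((hid.const_add _).add hid) (Or.inr (by finiteness))).add hid).add (hid.add hid)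
  simp only [add_zero] at hlim
  exact ge_of_tendsto hlim (eventually_mem_nhdsWithin.mono key)

/-- A layer cake bound for restricted integrals: if every superlevel set of `v` is bounded in
`ν`-measure by `c` times its `P`-measure, then so is the integral of `v`. -/
theorem lintegral_ofReal_le_mul_of_measure_lt_le {Ω : Type*} [MeasurableSpace Ω]
    {P ν : Measure Ω} {v : Ω → ℝ} (hv : Measurable v) (hv0 : ∀ ω, 0 ≤ v ω) {c : ℝ≥0∞} (hc : c ≠ ∞)
    (h : ∀ t, ν {ω | t < v ω} ≤ c * P {ω | t < v ω}) :
    ∫⁻ ω, ENNReal.ofReal (v ω) ∂ν ≤ c * ∫⁻ ω, ENNReal.ofReal (v ω) ∂P := by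
  rw [lintegral_eq_lintegral_meas_lt ν (ae_of_all _ hv0) hv.aemeasurable,
    lintegral_eq_lintegral_meas_lt P (ae_of_all _ hv0) hv.aemeasurable,
    ← lintegral_const_mul' _ _ hc]
  exact lintegral_mono h

/-- Random variables with negatively dependent superlevel sets have nonpositive covariance. -/
theorem integral_mul_le_of_measure_inter_le {Ω : Type*} [MeasurableSpace Ω]
    {P : Measure Ω} [IsProbabilityMeasure P] {u v : Ω → ℝ} (hu : Measurable u)
    (hv : Measurable v) {C D : ℝ} (huC : ∀ ω, |u ω| ≤ C) (hvD : ∀ ω, |v ω| ≤ D)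
    (h : ∀ s t, P ({ω | s < u ω} ∩ {ω | t < v ω}) ≤ P {ω | s < u ω} * P {ω | t < v ω}) :
    ∫ ω, u ω * v ω ∂P ≤ (∫ ω, u ω ∂P) * ∫ ω, v ω ∂P := by
  have hui : Integrable u P := Integrable.of_bound hu.aestronglyMeasurable C (ae_of_all _ huC)
  have hvi : Integrable v P := Integrable.of_bound hv.aestronglyMeasurable D (ae_of_all _ hvD)
  have huvi : Integrable (fun ω => u ω * v ω) P := hui.mul_bdd hv.aestronglyMeasurable
    (ae_of_all _ hvD)
  have hu0 : ∀ ω, 0 ≤ u ω + C := fun ω => by linarith [neg_le_of_abs_le (huC ω)]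
  have hv0 : ∀ ω, 0 ≤ v ω + D := fun ω => by linarith [neg_le_of_abs_le (hvD ω)]
  have hu' : Measurable fun ω => u ω + C := hu.add_const C
  have hv' : Measurable fun ω => v ω + D := hv.add_const D
  have hui' : Integrable (fun ω => u ω + C) P := hui.add (integrable_const C)
  have hvi' : Integrable (fun ω => v ω + D) P := hvi.add (integrable_const D)
  have hvfin : ∫⁻ ω, ENNReal.ofReal (v ω + D) ∂P ≠ ∞ := hvi'.lintegral_lt_top.ne
  have hufin : ∫⁻ ω, ENNReal.ofReal (u ω + C) ∂P ≠ ∞ := hui'.lintegral_lt_top.ne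
  have hset : ∀ s, MeasurableSet {ω | s < u ω + C} := fun s => measurableSet_lt measurable_const hu'
  have hsetv : ∀ s, MeasurableSet {ω | s < v ω + D} :=
    fun s => measurableSet_lt measurable_const hv'
  have hinner : ∀ s, ∫⁻ ω in {ω | s < u ω + C}, ENNReal.ofReal (v ω + D) ∂P ≤
      P {ω | s < u ω + C} * ∫⁻ ω, ENNReal.ofReal (v ω + D) ∂P := fun s =>
    lintegral_ofReal_le_mul_of_measure_lt_le hv' hv0 (measure_ne_top P _) fun t => by
      rw [Measure.restrict_apply (hsetv t), inter_comm]
      simpa only [sub_lt_iff_lt_add] using h (s - C) (t - D)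
  have hmul : ∫⁻ ω, ENNReal.ofReal ((u ω + C) * (v ω + D)) ∂P ≤
      (∫⁻ ω, ENNReal.ofReal (u ω + C) ∂P) * ∫⁻ ω, ENNReal.ofReal (v ω + D) ∂P := by
    have houter := lintegral_ofReal_le_mul_of_measure_lt_le (P := P)
      (ν := P.withDensity fun ω => ENNReal.ofReal (v ω + D)) hu' hu0 hvfin fun s => by
        rw [withDensity_apply _ (hset s), mul_comm]
        exact hinner s
    rw [lintegral_withDensity_eq_lintegral_mul _ hv'.ennreal_ofReal hu'.ennreal_ofReal,
      mul_comm (∫⁻ ω, ENNReal.ofReal (v ω + D) ∂P)] at houter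
    refine le_trans (le_of_eq (lintegral_congr fun ω => ?_)) houter
    rw [ENNReal.ofReal_mul (hu0 ω), Pi.mul_apply, mul_comm]
  have hreal : ∫ ω, (u ω + C) * (v ω + D) ∂P ≤
      (∫ ω, (u ω + C) ∂P) * ∫ ω, (v ω + D) ∂P := by
    rw [integral_eq_lintegral_of_nonneg_ae (ae_of_all _ fun ω => mul_nonneg (hu0 ω) (hv0 ω))
        (hu'.mul hv').aestronglyMeasurable,
      integral_eq_lintegral_of_nonneg_ae (ae_of_all _ hu0) hu'.aestronglyMeasurable,
      integral_eq_lintegral_of_nonneg_ae (ae_of_all _ hv0) hv'.aestronglyMeasurable,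
      ← ENNReal.toReal_mul]
    exact ENNReal.toReal_mono (ENNReal.mul_ne_top hufin hvfin) hmul
  have hexp : ∫ ω, (u ω + C) * (v ω + D) ∂P =
      ∫ ω, u ω * v ω ∂P + D * ∫ ω, u ω ∂P + C * ∫ ω, v ω ∂P + C * D := by
    have : ∀ ω, (u ω + C) * (v ω + D) = u ω * v ω + D * u ω + C * v ω + C * D :=
      fun ω => by ring
    simp_rw [this]
    have hDu : Integrable (fun ω => D * u ω) P := hui.const_mul D
    have hCv : Integrable (fun ω => C * v ω) P := hvi.const_mul C
    have h₁ : Integrable (fun ω => u ω * v ω + D * u ω) P := huvi.add hDu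
    have h₂ : Integrable (fun ω => u ω * v ω + D * u ω + C * v ω) P := h₁.add hCv
    rw [integral_add h₂ (integrable_const _), integral_add h₁ hCv, integral_add huvi hDu,
      integral_const_mul, integral_const_mul]
    simp
  rw [hexp, integral_add hui (integrable_const C), integral_add hvi (integrable_const D)] at hreal
  simp only [integral_const, probReal_univ, smul_eq_mul, one_mul] at hreal
  linarith

/-- The indicator function of an upper set is nondecreasing. -/
theorem IsUpperSet.monotone_indicator_one {Y : Type*} [Preorder Y] {A : Set Y}
    (hA : IsUpperSet A) : Monotone (A.indicator (1 : Y → ℝ)) := by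
  intro x y hxy
  by_cases hx : x ∈ A
  · simp [hx, hA hxy hx]
  · rw [indicator_of_notMem hx]
    exact indicator_nonneg (fun _ _ => zero_le_one) y

/-- Negatively associated families have negatively dependent upper sets. -/
theorem NegAssoc.measure_inter_le {Ω ι X : Type*} [MeasurableSpace Ω] [MeasurableSpace X]
    [Preorder X] {P : Measure Ω} [IsProbabilityMeasure P] {Xs : ι → Ω → X}
    (h : NegAssoc P Xs) (hXs : ∀ i, Measurable (Xs i)) (J : Set ι) {A : Set (J → X)}
    {B : Set ((Jᶜ : Set ι) → X)} (hAm : MeasurableSet A) (hA : IsUpperSet A)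
    (hBm : MeasurableSet B) (hB : IsUpperSet B) :
    P ((fun ω (j : J) => Xs j ω) ⁻¹' A ∩ (fun ω (j : (Jᶜ : Set ι)) => Xs j ω) ⁻¹' B) ≤
      P ((fun ω (j : J) => Xs j ω) ⁻¹' A) *
        P ((fun ω (j : (Jᶜ : Set ι)) => Xs j ω) ⁻¹' B) := by
  have hpA : MeasurableSet ((fun ω (j : J) => Xs j ω) ⁻¹' A) :=
    (measurable_pi_lambda (fun ω (j : J) => Xs j ω) fun j => hXs j) hAm
  have hqB : MeasurableSet ((fun ω (j : (Jᶜ : Set ι)) => Xs j ω) ⁻¹' B) :=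
    (measurable_pi_lambda (fun ω (j : (Jᶜ : Set ι)) => Xs j ω) fun j => hXs j) hBm
  have hcov := h J (A.indicator 1) (B.indicator 1) (measurable_one.indicator hAm)
    hA.monotone_indicator_one ⟨1, fun x => by by_cases hx : x ∈ A <;> simp [hx]⟩
    (measurable_one.indicator hBm) hB.monotone_indicator_one
    ⟨1, fun x => by by_cases hx : x ∈ B <;> simp [hx]⟩
  have hprod : ∀ ω, A.indicator (1 : (J → X) → ℝ) (fun j => Xs j ω) *
      B.indicator (1 : ((Jᶜ : Set ι) → X) → ℝ) (fun j => Xs j ω) =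
      ((fun ω (j : J) => Xs j ω) ⁻¹' A ∩
        (fun ω (j : (Jᶜ : Set ι)) => Xs j ω) ⁻¹' B).indicator 1 ω := by
    intro ω
    rw [inter_indicator_one]
    rfl
  have hIA : ∫ ω, A.indicator (1 : (J → X) → ℝ) (fun j => Xs j ω) ∂P =
      P.real ((fun ω (j : J) => Xs j ω) ⁻¹' A) := integral_indicator_one hpA
  have hIB : ∫ ω, B.indicator (1 : ((Jᶜ : Set ι) → X) → ℝ) (fun j => Xs j ω) ∂P =
      P.real ((fun ω (j : (Jᶜ : Set ι)) => Xs j ω) ⁻¹' B) := integral_indicator_one hqB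
  simp_rw [hprod] at hcov
  rw [integral_indicator_one (hpA.inter hqB), hIA, hIB, measureReal_def, measureReal_def,
    measureReal_def, ← ENNReal.toReal_mul] at hcov
  exact (ENNReal.toReal_le_toReal (by finiteness) (by finiteness)).1 hcov

/-- Negative association of countable families of random elements of a partially ordered
Polish space with closed partial order is preserved under convergence in distribution.
Here the families are identified with their joint laws `μs k` on the product space
`ι → X`, with coordinate projections as the random elements, and convergence in
distribution is weak convergence: the integrals of every bounded continuous function on
the product space converge. -/
theorem negAssoc_of_tendsto_negAssoc
    {ι X : Type*} [Countable ι]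
    [TopologicalSpace X] [PolishSpace X] [MeasurableSpace X] [BorelSpace X]
    [PartialOrder X] [OrderClosedTopology X]
    (μs : ℕ → Measure (ι → X)) (μ : Measure (ι → X))
    [∀ k, IsProbabilityMeasure (μs k)] [IsProbabilityMeasure μ]
    (hNA : ∀ k, NegAssoc (μs k) (fun i x => x i))
    (hconv : ∀ F : BoundedContinuousFunction (ι → X) ℝ,
      Tendsto (fun k => ∫ x, F x ∂(μs k)) atTop (nhds (∫ x, F x ∂μ))) :
    NegAssoc μ (fun i x => x i) := by
  intro J f g hf hfm ⟨C, hC⟩ hg hgm ⟨D, hD⟩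
  have hp : Continuous fun (x : ι → X) (j : J) => x j := by fun_prop
  have hq : Continuous fun (x : ι → X) (j : (Jᶜ : Set ι)) => x j := by fun_prop
  let νs : ℕ → ProbabilityMeasure (ι → X) := fun k => ⟨μs k, inferInstance⟩
  let ν : ProbabilityMeasure (ι → X) := ⟨μ, inferInstance⟩
  have hlim : Tendsto νs atTop (𝓝 ν) :=
    ProbabilityMeasure.tendsto_iff_forall_integral_tendsto.2 hconv
  refine integral_mul_le_of_measure_inter_le (hf.comp hp.measurable) (hg.comp hq.measurable)
    (fun _ => hC _) (fun _ => hD _) fun s t => ?_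
  exact measure_inter_le_mul_of_tendsto hlim hp hq
    (fun k A B hAm hA hBm hB => (hNA k).measure_inter_le measurable_pi_apply J hAm hA hBm hB)
    (measurableSet_lt measurable_const hf) (fun _ _ hxy hx => hx.trans_le (hfm hxy))
    (measurableSet_lt measurable_const hg) (fun _ _ hxy hx => hx.trans_le (hgm hxy))
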